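/- Assume the distributions with generating functions g_n and h_n have finite second moments, that n(m_n − 1) → a ∈ ℝ and ω_n → ω ≥ 0, and that the finite measures μ̃_n converge weakly to a finite measure μ̃ and ν̃_n converge weakly to a finite measure ν̃ as n → ∞. Take c_n = √n. Then μ̃ and ν̃ are supported on [0, ∞); the sequence {G_n} is uniformly Lipschitz on each bounded interval and for all λ ≥ 0, G_n(λ) → −(μ̃({0}) + a)λ²/2 − ∫_{(0,∞)} (e^{−λu} − 1 + λu) u^{−2} μ̃(du); and the sequence {H_n} is uniformly Lipschitz on each bounded interval and for all λ ≥ 0, H_n(λ) → −(ν̃({0}) + ω² − ω)λ²/2 − ∫_{(0,∞)} (e^{−λu} − 1 + λu) u^{−2} ν̃(du). -/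

import Mathlib

open MeasureTheory Filter Topology

/-- The probability generating function of an `ℕ`-valued distribution `p`. -/
noncomputable def pgf (p : ℕ → ℝ) (s : ℝ) : ℝ := ∑' i, p i * s ^ i

/-- The mean `g'(1) = ∑ i * p i` of an `ℕ`-valued distribution `p`. -/
noncomputable def pgfMean (p : ℕ → ℝ) : ℝ := ∑' i : ℕ, (i : ℝ) * p i

/-- `G_n(λ) = n² [(1 − m_n λ/√n) − g_n(1 − λ/√n)]` (i.e. with `c_n = √n`). -/
noncomputable def Gsq (p : ℕ → ℕ → ℝ) (n : ℕ) (l : ℝ) : ℝ :=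
  (n : ℝ) ^ 2 * ((1 - pgfMean (p n) * l / Real.sqrt n) - pgf (p n) (1 - l / Real.sqrt n))

/-- `H_n(λ) = n [(1 − ω_n λ/√n) − h_n(1 − λ/√n)]` (i.e. with `c_n = √n`). -/
noncomputable def Hsq (q : ℕ → ℕ → ℝ) (n : ℕ) (l : ℝ) : ℝ :=
  (n : ℝ) * ((1 - pgfMean (q n) * l / Real.sqrt n) - pgf (q n) (1 - l / Real.sqrt n))

/-- `μ̃_n(B) = n E[(ξ_n − m_n)² 1_B((ξ_n − m_n)/√n)]` for `ξ_n` with distribution `p_n`. -/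
noncomputable def tildeMu (p : ℕ → ℕ → ℝ) (n : ℕ) : Measure ℝ :=
  Measure.sum fun i : ℕ =>
    ENNReal.ofReal ((n : ℝ) * p n i * ((i : ℝ) - pgfMean (p n)) ^ 2) •
      Measure.dirac (((i : ℝ) - pgfMean (p n)) / Real.sqrt n)

/-- `ν̃_n(B) = E[(η_n − ω_n)² 1_B((η_n − ω_n)/√n)]` for `η_n` with distribution `q_n`. -/
noncomputable def tildeNu (q : ℕ → ℕ → ℝ) (n : ℕ) : Measure ℝ :=
  Measure.sum fun i : ℕ =>
    ENNReal.ofReal (q n i * ((i : ℝ) - pgfMean (q n)) ^ 2) •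
      Measure.dirac (((i : ℝ) - pgfMean (q n)) / Real.sqrt n)

/-- The kernel `(e^{-tv} - 1 + tv) / v²`, continuously extended to `v = 0`, in integral form. -/
noncomputable def expRemainder (t v : ℝ) : ℝ := ∫ s in (0 : ℝ)..t, (t - s) * Real.exp (-s * v)

lemma expRemainder_mul_sq (t v : ℝ) :
    expRemainder t v * v ^ 2 = Real.exp (-t * v) - 1 + t * v := by
  unfold expRemainder
  rw [← intervalIntegral.integral_mul_const]
  have h : ∀ s ∈ Set.uIcc 0 t,
      HasDerivAt (fun s : ℝ => -(t - s) * v * Real.exp (-s * v) + Real.exp (-s * v))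
        ((t - s) * Real.exp (-s * v) * v ^ 2) s := by
    intro s _
    have h1 : HasDerivAt (fun s : ℝ => Real.exp (-s * v)) (Real.exp (-s * v) * (-1 * v)) s :=
      (((hasDerivAt_id s).neg).mul_const v).exp
    have h2 : HasDerivAt (fun s : ℝ => -(t - s) * v) (-(-1) * v) s :=
      (((hasDerivAt_id s).const_sub t).neg).mul_const v
    refine ((h2.mul h1).add h1).congr_deriv ?_
    ring
  rw [intervalIntegral.integral_eq_sub_of_hasDerivAt h
    (Continuous.intervalIntegrable (by fun_prop) _ _)]
  simp
  ring

lemma expRemainder_of_ne_zero (t : ℝ) {v : ℝ} (hv : v ≠ 0) :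
    expRemainder t v = (Real.exp (-t * v) - 1 + t * v) / v ^ 2 := by
  rw [← expRemainder_mul_sq]
  field_simp

lemma expRemainder_zero_right (t : ℝ) : expRemainder t 0 = t ^ 2 / 2 := by
  have h := integral_id (a := 0) (b := t)
  simp only [expRemainder, mul_zero, Real.exp_zero, mul_one]
  rw [intervalIntegral.integral_sub (by simp) (by simp), h]
  simp
  ring

lemma expRemainder_zero_left (v : ℝ) : expRemainder 0 v = 0 := by
  simp [expRemainder]

lemma continuous_expRemainder (t : ℝ) : Continuous (expRemainder t) :=
  intervalIntegral.continuous_parametric_intervalIntegral_of_continuous' (by fun_prop) 0 t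

lemma abs_expRemainder_sub_le_of_le {T v t t' : ℝ} (hv : -1 ≤ v) (ht' : 0 ≤ t') (htt : t' ≤ t)
    (htT : t ≤ T) :
    |expRemainder t v - expRemainder t' v| ≤ 2 * T * Real.exp T * |t - t'| := by
  have hexp : ∀ s, 0 ≤ s → s ≤ T → Real.exp (-s * v) ≤ Real.exp T := fun s h0 h1 =>
    Real.exp_le_exp.2 (by nlinarith)
  have hint : ∀ a b, IntervalIntegrable (fun s => (t - s) * Real.exp (-s * v)) volume a b :=
    fun a b => Continuous.intervalIntegrable (by fun_prop) _ _
  have hint' : ∀ a b, IntervalIntegrable (fun s => (t' - s) * Real.exp (-s * v)) volume a b :=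
    fun a b => Continuous.intervalIntegrable (by fun_prop) _ _
  have hsplit : expRemainder t v - expRemainder t' v =
      (∫ s in (0 : ℝ)..t', (t - t') * Real.exp (-s * v)) +
        ∫ s in t'..t, (t - s) * Real.exp (-s * v) := by
    unfold expRemainder
    rw [← intervalIntegral.integral_add_adjacent_intervals (hint 0 t') (hint t' t),
      add_sub_right_comm, ← intervalIntegral.integral_sub (hint _ _) (hint' _ _)]
    congr 2
    ext s
    ring
  have hT : 0 ≤ t - t' := sub_nonneg.2 htt
  have b1 : ‖∫ s in (0 : ℝ)..t', (t - t') * Real.exp (-s * v)‖ ≤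
      ((t - t') * Real.exp T) * |t' - 0| := by
    refine intervalIntegral.norm_integral_le_of_norm_le_const fun s hs => ?_
    rw [Set.uIoc_of_le ht'] at hs
    rw [Real.norm_eq_abs, abs_mul, abs_of_nonneg hT, Real.abs_exp]
    exact mul_le_mul_of_nonneg_left (hexp s hs.1.le (by linarith [hs.2])) hT
  have b2 : ‖∫ s in t'..t, (t - s) * Real.exp (-s * v)‖ ≤ (T * Real.exp T) * |t - t'| := by
    refine intervalIntegral.norm_integral_le_of_norm_le_const fun s hs => ?_
    rw [Set.uIoc_of_le htt] at hs
    rw [Real.norm_eq_abs, abs_mul, abs_of_nonneg (by linarith [hs.2]), Real.abs_exp]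
    exact mul_le_mul (by linarith [hs.1]) (hexp s (by linarith [hs.1]) (by linarith [hs.2]))
      (Real.exp_pos _).le (by linarith)
  rw [hsplit]
  refine (abs_add_le _ _).trans ((add_le_add b1 b2).trans ?_)
  rw [sub_zero, abs_of_nonneg ht', abs_of_nonneg hT]
  have : (t - t') * Real.exp T * t' ≤ (t - t') * Real.exp T * T :=
    mul_le_mul_of_nonneg_left (by linarith) (mul_nonneg hT (Real.exp_pos _).le)
  linarith

lemma abs_expRemainder_sub_le {T v t t' : ℝ} (hv : -1 ≤ v) (ht : t ∈ Set.Icc 0 T)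
    (ht' : t' ∈ Set.Icc 0 T) :
    |expRemainder t v - expRemainder t' v| ≤ 2 * T * Real.exp T * |t - t'| := by
  rcases le_total t' t with h | h
  · exact abs_expRemainder_sub_le_of_le hv ht'.1 h ht.2
  · rw [abs_sub_comm, abs_sub_comm t]
    exact abs_expRemainder_sub_le_of_le hv ht.1 h ht'.2

lemma abs_expRemainder_le {T v : ℝ} (hv : -1 ≤ v) (hT : 0 ≤ T) :
    |expRemainder T v| ≤ 2 * T * Real.exp T * T := by
  simpa [expRemainder_zero_left, abs_of_nonneg hT] using
    abs_expRemainder_sub_le hv (Set.right_mem_Icc.2 hT) (Set.left_mem_Icc.2 hT)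

lemma pow_sub_pow_bounds {a b : ℝ} (hb : 0 ≤ b) (hab : b ≤ a) (ha : a ≤ 1) (i : ℕ) :
    0 ≤ a ^ i - b ^ i ∧ 0 ≤ i * (a - b) - (a ^ i - b ^ i) ∧
      i * (a - b) - (a ^ i - b ^ i) ≤ i * (i - 1) * (1 - b) * (a - b) := by
  induction i with
  | zero => simp
  | succ k ih =>
    obtain ⟨h0, h1, h2⟩ := ih
    have hk : (0 : ℝ) ≤ k := k.cast_nonneg
    have hbern : 1 - b ^ k ≤ k * (1 - b) := by
      have := one_add_mul_le_pow (a := b - 1) (by linarith) k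
      rw [add_sub_cancel] at this
      linarith
    have hbk : b ^ k ≤ 1 := pow_le_one₀ hb (hab.trans ha)
    have e : ((k + 1 : ℕ) : ℝ) * (a - b) - (a ^ (k + 1) - b ^ (k + 1)) =
        (k * (a - b) - (a ^ k - b ^ k)) + (1 - a) * (a ^ k - b ^ k) +
          (1 - b ^ k) * (a - b) := by
      push_cast
      ring
    have p1 : 0 ≤ (1 - a) * (a ^ k - b ^ k) := mul_nonneg (by linarith) h0
    have p2 : 0 ≤ (1 - b ^ k) * (a - b) := mul_nonneg (by linarith) (by linarith)
    have p3 : (1 - a) * (a ^ k - b ^ k) ≤ (1 - b) * (k * (a - b)) :=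
      mul_le_mul (by linarith) (by linarith) h0 (by linarith)
    have p4 : (1 - b ^ k) * (a - b) ≤ k * (1 - b) * (a - b) :=
      mul_le_mul_of_nonneg_right hbern (by linarith)
    refine ⟨sub_nonneg.2 (pow_le_pow_left₀ hb hab _), ?_, ?_⟩
    · rw [e]
      linarith
    · rw [e]
      push_cast
      nlinarith

section WeakLimit

variable {μs : ℕ → Measure ℝ} {μ : Measure ℝ} {ε : ℕ → ℝ}

lemma tendsto_measureReal_univ_of_weak
    (hweak : ∀ f : ℝ → ℝ, Continuous f → (∃ C, ∀ x : ℝ, |f x| ≤ C) →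
      Tendsto (fun n : ℕ => ∫ x, f x ∂(μs n)) atTop (𝓝 (∫ x, f x ∂μ))) :
    Tendsto (fun n => (μs n).real Set.univ) atTop (𝓝 (μ.real Set.univ)) := by
  simpa using hweak (fun _ => 1) continuous_const ⟨1, fun _ => by simp⟩

lemma measure_Iio_zero_of_weak [∀ n, IsFiniteMeasure (μs n)] [IsFiniteMeasure μ]
    (hε : Tendsto ε atTop (𝓝 0)) (hsupp : ∀ n, ∀ᵐ x ∂(μs n), -ε n ≤ x)
    (hweak : ∀ f : ℝ → ℝ, Continuous f → (∃ C, ∀ x : ℝ, |f x| ≤ C) →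
      Tendsto (fun n : ℕ => ∫ x, f x ∂(μs n)) atTop (𝓝 (∫ x, f x ∂μ))) :
    μ (Set.Iio 0) = 0 := by
  set f : ℝ → ℝ := fun x => min 1 (max 0 (-x)) with hf
  have hfc : Continuous f := by fun_prop
  have hf0 : 0 ≤ f := fun x => le_min zero_le_one (le_max_left _ _)
  have hf1 : ∀ x, |f x| ≤ 1 := fun x => by
    rw [abs_of_nonneg (hf0 x)]
    exact min_le_left _ _
  have hlim := hweak f hfc ⟨1, hf1⟩
  have hzero : Tendsto (fun n : ℕ => ∫ x, f x ∂(μs n)) atTop (𝓝 0) := by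
    have hb : Tendsto (fun n => |ε n| * (μs n).real Set.univ) atTop (𝓝 0) := by
      simpa using hε.abs.mul (tendsto_measureReal_univ_of_weak hweak)
    refine squeeze_zero_norm (fun n => ?_) hb
    refine norm_integral_le_of_norm_le_const ?_
    filter_upwards [hsupp n] with x hx
    rw [Real.norm_eq_abs, abs_of_nonneg (hf0 x)]
    exact (min_le_right _ _).trans (max_le (abs_nonneg _) (by linarith [le_abs_self (ε n)]))
  have hint : Integrable f μ :=
    Integrable.of_bound hfc.aestronglyMeasurable 1 (Eventually.of_forall hf1)
  have hae := (integral_eq_zero_iff_of_nonneg hf0 hint).1 (tendsto_nhds_unique hlim hzero)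
  refine measure_mono_null (fun x hx => ?_) hae
  have hx' : 0 < f x := lt_min zero_lt_one (lt_max_of_lt_right (neg_pos.2 hx))
  exact hx'.ne'

lemma tendsto_integral_expRemainder [∀ n, IsFiniteMeasure (μs n)] [IsFiniteMeasure μ]
    (hε : Tendsto ε atTop (𝓝 0)) (hsupp : ∀ n, ∀ᵐ x ∂(μs n), -ε n ≤ x)
    (hweak : ∀ f : ℝ → ℝ, Continuous f → (∃ C, ∀ x : ℝ, |f x| ≤ C) →
      Tendsto (fun n : ℕ => ∫ x, f x ∂(μs n)) atTop (𝓝 (∫ x, f x ∂μ)))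
    {t : ℕ → ℝ} {l : ℝ} (hl : 0 ≤ l) (ht : Tendsto t atTop (𝓝 l)) (ht0 : ∀ᶠ n in atTop, 0 ≤ t n) :
    Tendsto (fun n => ∫ x, expRemainder (t n) x ∂(μs n)) atTop
      (𝓝 (∫ x, expRemainder l x ∂μ)) := by
  set T := l + 1 with hT
  set K := 2 * T * Real.exp T with hK
  set f : ℝ → ℝ := fun x => expRemainder l (max x (-1)) with hf
  have hfc : Continuous f := (continuous_expRemainder l).comp (by fun_prop)
  have hlim := hweak f hfc ⟨_, fun x => abs_expRemainder_le (le_max_right _ _) hl⟩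
  have hfint : ∀ n, Integrable f (μs n) := fun n =>
    Integrable.of_bound hfc.aestronglyMeasurable _
      (Eventually.of_forall fun x => abs_expRemainder_le (le_max_right _ _) hl)
  have hμ : ∫ x, f x ∂μ = ∫ x, expRemainder l x ∂μ := by
    refine integral_congr_ae ?_
    have h0 : ∀ᵐ x ∂μ, ¬ x < 0 := measure_eq_zero_iff_ae_notMem.1
      (measure_Iio_zero_of_weak hε hsupp hweak)
    filter_upwards [h0] with x hx
    simp only [hf]
    rw [max_eq_left (by linarith)]
  rw [← hμ]
  refine tendsto_of_tendsto_of_dist hlim ?_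
  have hb : Tendsto (fun n => K * |t n - l| * (μs n).real Set.univ) atTop (𝓝 0) := by
    have h1 : Tendsto (fun n => |t n - l|) atTop (𝓝 0) := by
      simpa using (ht.sub_const l).abs
    simpa using (h1.const_mul K).mul (tendsto_measureReal_univ_of_weak hweak)
  refine squeeze_zero' (Eventually.of_forall fun _ => dist_nonneg) ?_ hb
  filter_upwards [ht0, ht.eventually (eventually_le_nhds (show l < T by linarith)),
    hε.eventually (eventually_le_nhds zero_lt_one)] with n hn0 hnT hnε
  have hae : ∀ᵐ x ∂(μs n), -1 ≤ x := by
    filter_upwards [hsupp n] with x hx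
    linarith
  have hint : Integrable (expRemainder (t n)) (μs n) := by
    refine Integrable.of_bound (continuous_expRemainder _).aestronglyMeasurable
      (2 * t n * Real.exp (t n) * t n) ?_
    filter_upwards [hae] with x hx
    exact abs_expRemainder_le hx hn0
  rw [dist_comm, dist_eq_norm, ← integral_sub hint (hfint n)]
  refine norm_integral_le_of_norm_le_const ?_
  filter_upwards [hae] with x hx
  simp only [hf]
  rw [max_eq_left hx]
  exact abs_expRemainder_sub_le hx ⟨hn0, hnT⟩ ⟨hl, by linarith⟩

lemma integral_expRemainder_eq [IsFiniteMeasure μ] (hμ : μ (Set.Iio 0) = 0) {l : ℝ}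
    (hl : 0 ≤ l) :
    ∫ x, expRemainder l x ∂μ = (μ {0}).toReal * l ^ 2 / 2 +
      ∫ u in Set.Ioi (0 : ℝ), (Real.exp (-l * u) - 1 + l * u) / u ^ 2 ∂μ := by
  have h0 : ∀ᵐ x ∂μ, ¬ x < 0 := measure_eq_zero_iff_ae_notMem.1 hμ
  have hint : Integrable (expRemainder l) μ := by
    refine Integrable.of_bound (continuous_expRemainder _).aestronglyMeasurable
      (2 * l * Real.exp l * l) ?_
    filter_upwards [h0] with x hx
    exact abs_expRemainder_le (by linarith) hl
  have huniv : ∫ x, expRemainder l x ∂μ = ∫ x in {0} ∪ Set.Ioi 0, expRemainder l x ∂μ := by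
    rw [← setIntegral_univ]
    refine setIntegral_congr_set ?_
    filter_upwards [h0] with x hx
    refine propext ⟨fun _ => ?_, fun _ => trivial⟩
    rcases (not_lt.1 hx).eq_or_lt with h | h
    · exact Or.inl h.symm
    · exact Or.inr h
  rw [huniv, setIntegral_union (by simp) measurableSet_Ioi hint.integrableOn hint.integrableOn,
    integral_singleton, expRemainder_zero_right]
  congr 1
  · rw [measureReal_def, smul_eq_mul]
    ring
  · exact setIntegral_congr_fun measurableSet_Ioi fun u hu =>
      expRemainder_of_ne_zero l (ne_of_gt hu)

end WeakLimit

section Rate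

lemma exists_exponential_rate {l : ℝ} (hl : 0 ≤ l) :
    ∃ θ : ℕ → ℝ, (∀ᶠ n : ℕ in atTop, 0 < n ∧ 0 ≤ θ n ∧ Real.exp (-θ n) = 1 - l / √n) ∧
      Tendsto (fun n : ℕ => √n * θ n) atTop (𝓝 l) := by
  have hsqrt : Tendsto (fun n : ℕ => √(n : ℝ)) atTop atTop :=
    Real.tendsto_sqrt_atTop.comp tendsto_natCast_atTop_atTop
  refine ⟨fun n => -Real.log (1 - l / √n), ?_, ?_⟩
  · filter_upwards [eventually_gt_atTop 0, hsqrt.eventually (eventually_gt_atTop l)] with n hn hln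
    have hr : 0 < √(n : ℝ) := hl.trans_lt hln
    have h1 : l / √n < 1 := (div_lt_one hr).2 hln
    have h2 : 0 ≤ l / √n := div_nonneg hl hr.le
    refine ⟨hn, neg_nonneg.2 (Real.log_nonpos (by linarith) (by linarith)), ?_⟩
    rw [neg_neg, Real.exp_log (by linarith)]
  · have h := ((Real.tendsto_mul_log_one_add_div_atTop (-l)).comp hsqrt).neg
    rw [neg_neg] at h
    refine h.congr fun n => ?_
    simp only [Function.comp_apply]
    rw [neg_div, ← sub_eq_add_neg]
    ring

variable {l : ℝ} {θ : ℕ → ℝ}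

lemma tendsto_rate_zero (ht : Tendsto (fun n : ℕ => √n * θ n) atTop (𝓝 l)) :
    Tendsto θ atTop (𝓝 0) := by
  have hsqrt : Tendsto (fun n : ℕ => √(n : ℝ)) atTop atTop :=
    Real.tendsto_sqrt_atTop.comp tendsto_natCast_atTop_atTop
  refine (ht.div_atTop hsqrt).congr' ?_
  filter_upwards [eventually_gt_atTop 0] with n hn
  have : 0 < √(n : ℝ) := Real.sqrt_pos.2 (by exact_mod_cast hn)
  field_simp

lemma tendsto_expRemainder_one_comp {u : ℕ → ℝ} (hu : Tendsto u atTop (𝓝 0)) :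
    Tendsto (fun n => expRemainder 1 (u n)) atTop (𝓝 (1 / 2)) := by
  have h := ((continuous_expRemainder 1).tendsto 0).comp hu
  rw [expRemainder_zero_right, one_pow] at h
  exact h

lemma exp_neg_eq_expRemainder (u : ℝ) :
    Real.exp (-u) = 1 - u + expRemainder 1 u * u ^ 2 := by
  rw [expRemainder_mul_sq, neg_one_mul]
  ring

variable (hθ : ∀ᶠ n : ℕ in atTop, 0 < n ∧ 0 ≤ θ n ∧ Real.exp (-θ n) = 1 - l / √n)
  (ht : Tendsto (fun n : ℕ => √n * θ n) atTop (𝓝 l))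

include hθ ht

lemma tendsto_drift_of_tendsto {m : ℕ → ℝ} {ω : ℝ} (hm : Tendsto m atTop (𝓝 ω)) :
    Tendsto (fun n : ℕ => (n : ℝ) * (1 - m n * l / √n - Real.exp (-(m n * θ n)))) atTop
      (𝓝 (-(ω ^ 2 - ω) * l ^ 2 / 2)) := by
  have h0 := tendsto_rate_zero ht
  have h1 := tendsto_expRemainder_one_comp h0
  have h2 : Tendsto (fun n => expRemainder 1 (m n * θ n)) atTop (𝓝 (1 / 2)) :=
    tendsto_expRemainder_one_comp (by simpa using hm.mul h0)
  have h := ((ht.pow 2).mul hm).mul (h1.sub (hm.mul h2))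
  have e : l ^ 2 * ω * (1 / 2 - ω * (1 / 2)) = -(ω ^ 2 - ω) * l ^ 2 / 2 := by ring
  rw [e] at h
  refine h.congr' ?_
  filter_upwards [hθ] with n hn
  have hx : l / √n = θ n - expRemainder 1 (θ n) * θ n ^ 2 := by
    have := hn.2.2
    rw [exp_neg_eq_expRemainder] at this
    linarith
  rw [mul_div_assoc, hx, exp_neg_eq_expRemainder (m n * θ n), mul_pow,
    Real.sq_sqrt (Nat.cast_nonneg n)]
  ring

lemma tendsto_drift_of_tendsto_mul_sub_one {m : ℕ → ℝ} {a : ℝ}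
    (hm : Tendsto (fun n : ℕ => (n : ℝ) * (m n - 1)) atTop (𝓝 a)) :
    Tendsto (fun n : ℕ => (n : ℝ) * (n * (1 - m n * l / √n - Real.exp (-(m n * θ n))))) atTop
      (𝓝 (-a * l ^ 2 / 2)) := by
  have h0 := tendsto_rate_zero ht
  have h1 := tendsto_expRemainder_one_comp h0
  have hδ : Tendsto (fun n => m n - 1) atTop (𝓝 0) := by
    refine (hm.div_atTop tendsto_natCast_atTop_atTop).congr' ?_
    filter_upwards [eventually_gt_atTop 0] with n hn
    have : (0 : ℝ) < n := by exact_mod_cast hn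
    field_simp
  have h2 : Tendsto (fun n => expRemainder 1 ((m n - 1) * θ n)) atTop (𝓝 (1 / 2)) :=
    tendsto_expRemainder_one_comp (by simpa using hδ.mul h0)
  have hexp : Tendsto (fun n => Real.exp (-θ n)) atTop (𝓝 1) := by
    simpa using h0.neg.rexp
  have h := (hm.mul ((h1.mul (ht.pow 2)).sub (ht.const_mul l))).sub
    (((hexp.mul h2).mul (hm.pow 2)).mul (h0.pow 2))
  have e : a * (1 / 2 * l ^ 2 - l * l) - 1 * (1 / 2) * a ^ 2 * 0 ^ 2 = -a * l ^ 2 / 2 := by ring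
  rw [e] at h
  refine h.congr' ?_
  filter_upwards [hθ] with n hn
  obtain ⟨hn0, -, hn2⟩ := hn
  have hr : 0 < √(n : ℝ) := Real.sqrt_pos.2 (by exact_mod_cast hn0)
  set x := l / √n with hx
  have hl : l = x * √n := by
    rw [hx]
    field_simp
  have hx' : expRemainder 1 (θ n) * θ n ^ 2 = θ n - x := by
    have := hn2
    rw [exp_neg_eq_expRemainder] at this
    linarith
  have hexp' : Real.exp (-(m n * θ n)) = (1 - x) * (1 - (m n - 1) * θ n +
      expRemainder 1 ((m n - 1) * θ n) * ((m n - 1) * θ n) ^ 2) := by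
    rw [← exp_neg_eq_expRemainder, ← hn2, ← Real.exp_add]
    congr 1
    ring
  have e1 : expRemainder 1 (θ n) * (√n * θ n) ^ 2 - l * (√n * θ n) =
      n * (θ n - x - x * θ n) := by
    rw [mul_pow, mul_left_comm, hx', hl]
    have := Real.sq_sqrt (Nat.cast_nonneg (α := ℝ) n)
    linear_combination (θ n - x - x * θ n) * this
  rw [e1, mul_div_assoc, hexp', hn2]
  ring

end Rate

section ScaledMeasure

/-- The measure `κ E[(ξ - m)² 1_B((ξ - m)/√n)]` for `ξ` with distribution `P` and mean `m`. -/
noncomputable def scaledMeasure (κ : ℝ) (P : ℕ → ℝ) (n : ℕ) : Measure ℝ :=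
  Measure.sum fun i : ℕ =>
    ENNReal.ofReal (κ * P i * ((i : ℝ) - pgfMean P) ^ 2) •
      Measure.dirac (((i : ℝ) - pgfMean P) / Real.sqrt n)

variable {P : ℕ → ℝ} {κ : ℝ} {n : ℕ}

lemma hasSum_one_of_tsum_eq (h1 : ∑' i, P i = 1) : HasSum P 1 := by
  have hs : Summable P := by
    by_contra h
    rw [tsum_eq_zero_of_not_summable h] at h1
    exact zero_ne_one h1
  exact h1 ▸ hs.hasSum

variable (h0 : ∀ i, 0 ≤ P i) (h1 : ∑' i, P i = 1) (h2 : Summable fun i : ℕ => (i : ℝ) ^ 2 * P i)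

include h0 in
lemma pgfMean_nonneg : 0 ≤ pgfMean P :=
  tsum_nonneg fun i => mul_nonneg i.cast_nonneg (h0 i)

include h0 h2

lemma hasSum_pgfMean : HasSum (fun i : ℕ => (i : ℝ) * P i) (pgfMean P) := by
  refine (Summable.of_nonneg_of_le (fun i => mul_nonneg i.cast_nonneg (h0 i)) (fun i => ?_)
    h2).hasSum
  refine mul_le_mul_of_nonneg_right ?_ (h0 i)
  exact_mod_cast Nat.le_self_pow two_ne_zero i

include h1

lemma hasSum_centered_sq : HasSum (fun i : ℕ => κ * P i * ((i : ℝ) - pgfMean P) ^ 2)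
    (κ * (∑' i : ℕ, (i : ℝ) ^ 2 * P i - pgfMean P ^ 2)) := by
  have h := ((h2.hasSum.sub ((hasSum_pgfMean h0 h2).mul_left (2 * pgfMean P))).add
    ((hasSum_one_of_tsum_eq h1).mul_left (pgfMean P ^ 2))).mul_left κ
  convert! h using 1
  · ext i
    ring
  · ring

lemma isFiniteMeasure_scaledMeasure : IsFiniteMeasure (scaledMeasure κ P n) := by
  refine ⟨?_⟩
  rw [scaledMeasure, Measure.sum_apply _ MeasurableSet.univ]
  simpa using (hasSum_centered_sq h0 h1 h2 (κ := κ)).summable.tsum_ofReal_lt_top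

omit h0 h1 h2 in
lemma ae_scaledMeasure : ∀ᵐ x ∂(scaledMeasure κ P n), -(pgfMean P / √n) ≤ x := by
  rw [scaledMeasure, Measure.ae_sum_iff]
  refine fun i => Measure.ae_smul_measure ((ae_dirac_iff measurableSet_Ici).2 ?_) _
  rw [← neg_div]
  exact div_le_div_of_nonneg_right (by linarith [i.cast_nonneg (α := ℝ)]) (Real.sqrt_nonneg _)

omit h1 h2 in
lemma integral_scaledMeasure (hκ : 0 ≤ κ) (f : ℝ → ℝ) :
    ∫ x, f x ∂(scaledMeasure κ P n) =
      ∑' i : ℕ, κ * P i * ((i : ℝ) - pgfMean P) ^ 2 * f (((i : ℝ) - pgfMean P) / √n) := by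
  rw [scaledMeasure, integral_sum_dirac fun i => ENNReal.ofReal_ne_top]
  refine tsum_congr fun i => ?_
  rw [ENNReal.toReal_ofReal (mul_nonneg (mul_nonneg hκ (h0 i)) (sq_nonneg _)), smul_eq_mul]

lemma measureReal_scaledMeasure_univ (hκ : 0 ≤ κ) :
    (scaledMeasure κ P n).real Set.univ =
      κ * (∑' i : ℕ, (i : ℝ) ^ 2 * P i - pgfMean P ^ 2) := by
  have h := integral_scaledMeasure (n := n) h0 hκ fun _ => 1
  simp only [mul_one, integral_const, smul_eq_mul] at h
  rw [h]
  exact (hasSum_centered_sq h0 h1 h2).tsum_eq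

omit h2 in
lemma summable_pgf {s : ℝ} (hs : s ∈ Set.Icc (0 : ℝ) 1) : Summable fun i => P i * s ^ i :=
  Summable.of_nonneg_of_le (fun i => mul_nonneg (h0 i) (pow_nonneg hs.1 i))
    (fun i => mul_le_of_le_one_right (h0 i) (pow_le_one₀ hs.1 hs.2))
    (hasSum_one_of_tsum_eq h1).summable

lemma integral_expRemainder_scaledMeasure (hκ : 0 ≤ κ) (hn : 0 < n) {θ : ℝ} (hθ : 0 ≤ θ) :
    ∫ x, expRemainder (√n * θ) x ∂(scaledMeasure κ P n) =
      κ * (n * (Real.exp (pgfMean P * θ) * pgf P (Real.exp (-θ)) - 1)) := by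
  have hr : 0 < √(n : ℝ) := Real.sqrt_pos.2 (by exact_mod_cast hn)
  have hpgf := (summable_pgf h0 h1 (s := Real.exp (-θ))
    ⟨(Real.exp_pos _).le, Real.exp_le_one_iff.2 (by linarith)⟩).hasSum
  have hone := hasSum_one_of_tsum_eq h1
  have h := ((((hpgf.mul_left (Real.exp (pgfMean P * θ))).sub hone).add
    (((hasSum_pgfMean h0 h2).sub (hone.mul_left (pgfMean P))).mul_left θ)).mul_left
      (n : ℝ)).mul_left κ
  rw [mul_one, sub_self, mul_zero, add_zero] at h
  rw [integral_scaledMeasure h0 hκ, pgf, ← h.tsum_eq]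
  refine tsum_congr fun i => ?_
  set y := (i : ℝ) - pgfMean P with hy
  have hsq : y ^ 2 = n * (y / √n) ^ 2 := by
    rw [div_pow, Real.sq_sqrt (Nat.cast_nonneg n)]
    have : (0 : ℝ) < n := by exact_mod_cast hn
    field_simp
  have hexp : Real.exp (-(√n * θ) * (y / √n)) =
      Real.exp (pgfMean P * θ) * Real.exp (-θ) ^ i := by
    rw [← Real.exp_nat_mul, ← Real.exp_add]
    congr 1
    rw [hy]
    field_simp
    ring
  have hlin : √n * θ * (y / √n) = θ * y := by field_simp
  have := expRemainder_mul_sq (√n * θ) (y / √n)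
  rw [hexp, hlin] at this
  rw [hsq]
  have e : κ * P i * (n * (y / √n) ^ 2) * expRemainder (√n * θ) (y / √n) =
      κ * P i * n * (expRemainder (√n * θ) (y / √n) * (y / √n) ^ 2) := by ring
  rw [e, this, hy]
  ring

lemma abs_generator_sub_le (hκ : 0 ≤ κ) {M l l' : ℝ} (hl : l ∈ Set.Icc 0 M)
    (hl' : l' ∈ Set.Icc 0 M) (hln : l ≤ √n) (hln' : l' ≤ √n) :
    |κ * (n * (1 - pgfMean P * l / √n - pgf P (1 - l / √n))) -
        κ * (n * (1 - pgfMean P * l' / √n - pgf P (1 - l' / √n)))| ≤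
      (((scaledMeasure κ P n).real Set.univ) + κ * (pgfMean P ^ 2 - pgfMean P)) * M *
        |l - l'| := by
  wlog hll : l' ≤ l generalizing l l'
  · rw [abs_sub_comm, abs_sub_comm l]
    exact this hl' hl hln' hln (not_le.1 hll).le
  have hM : 0 ≤ M := hl.1.trans hl.2
  rw [measureReal_scaledMeasure_univ h0 h1 h2 hκ]
  set S := ∑' i : ℕ, (i : ℝ) ^ 2 * P i with hS
  have hr : 0 ≤ √(n : ℝ) := Real.sqrt_nonneg _
  set x := l / √n with hx
  set x' := l' / √n with hx'
  have hx0' : 0 ≤ x' := div_nonneg hl'.1 hr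
  have hxx : x' ≤ x := div_le_div_of_nonneg_right hll hr
  have hx1 : x ≤ 1 := div_le_one_of_le₀ hln hr
  have hmem : 1 - x ∈ Set.Icc (0 : ℝ) 1 := ⟨by linarith, by linarith⟩
  have hmem' : 1 - x' ∈ Set.Icc (0 : ℝ) 1 := ⟨by linarith, by linarith⟩
  have hm := hasSum_pgfMean h0 h2
  have hD : HasSum (fun i : ℕ => P i * (i * ((1 - x') - (1 - x)) - ((1 - x') ^ i - (1 - x) ^ i)))
      (pgfMean P * (x - x') - (pgf P (1 - x') - pgf P (1 - x))) := by
    have h := (hm.mul_right (x - x')).sub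
      ((summable_pgf h0 h1 hmem').hasSum.sub (summable_pgf h0 h1 hmem).hasSum)
    convert! h using 1
    ext i
    ring
  have hB : HasSum (fun i : ℕ => P i * (i * (i - 1) * (1 - (1 - x)) * ((1 - x') - (1 - x))))
      ((S - pgfMean P) * (x * (x - x'))) := by
    have h := (h2.hasSum.sub hm).mul_right (x * (x - x'))
    convert! h using 1
    ext i
    ring
  have hpb := fun i : ℕ => pow_sub_pow_bounds hmem.1 (by linarith) hmem'.2 i (a := 1 - x')
  have hD0 := HasSum.nonneg (fun i => mul_nonneg (h0 i) (hpb i).2.1) hD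
  have hDB := hasSum_le (fun i => mul_le_mul_of_nonneg_left (hpb i).2.2 (h0 i)) hD hB
  have hSm : 0 ≤ S - pgfMean P := by
    refine HasSum.nonneg (fun i => ?_) (h2.hasSum.sub hm)
    rw [← sub_mul]
    refine mul_nonneg (sub_nonneg.2 ?_) (h0 i)
    exact_mod_cast Nat.le_self_pow two_ne_zero i
  have hnx : n * (x * (x - x')) ≤ M * (l - l') := by
    rcases Nat.eq_zero_or_pos n with h | h
    · rw [h, Nat.cast_zero, zero_mul]
      exact mul_nonneg hM (sub_nonneg.2 hll)
    · have hr' : 0 < √(n : ℝ) := Real.sqrt_pos.2 (by exact_mod_cast h)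
      have hl1 : √n * x = l := by rw [hx]; field_simp
      have hl2 : √n * x' = l' := by rw [hx']; field_simp
      have e : n * (x * (x - x')) = l * (l - l') := by
        have := Real.sq_sqrt (Nat.cast_nonneg (α := ℝ) n)
        rw [← hl1, ← hl2]
        linear_combination -(x * (x - x')) * this
      rw [e]
      exact mul_le_mul_of_nonneg_right hl.2 (sub_nonneg.2 hll)
  have hkn : 0 ≤ κ * n := mul_nonneg hκ n.cast_nonneg
  have e : κ * (n * (1 - pgfMean P * l / √n - pgf P (1 - x))) -
        κ * (n * (1 - pgfMean P * l' / √n - pgf P (1 - x'))) =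
      -(κ * n * (pgfMean P * (x - x') - (pgf P (1 - x') - pgf P (1 - x)))) := by
    rw [mul_div_assoc, mul_div_assoc, ← hx, ← hx']
    ring
  rw [e, abs_neg, abs_of_nonneg (mul_nonneg hkn hD0), abs_of_nonneg (sub_nonneg.2 hll)]
  calc _ ≤ κ * n * ((S - pgfMean P) * (x * (x - x'))) := mul_le_mul_of_nonneg_left hDB hkn
    _ = κ * (S - pgfMean P) * (n * (x * (x - x'))) := by ring
    _ ≤ κ * (S - pgfMean P) * (M * (l - l')) :=
      mul_le_mul_of_nonneg_left hnx (mul_nonneg hκ hSm)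
    _ = _ := by ring

end ScaledMeasure

section Triangular

variable {p : ℕ → ℕ → ℝ} {κ : ℕ → ℝ} {m : ℝ} {μ : Measure ℝ} [IsFiniteMeasure μ]
  (hκ : ∀ n, 0 ≤ κ n) (h0 : ∀ n i, 0 ≤ p n i) (h1 : ∀ n, ∑' i, p n i = 1)
  (h2 : ∀ n, Summable fun i : ℕ => (i : ℝ) ^ 2 * p n i)
  (hm : Tendsto (fun n => pgfMean (p n)) atTop (𝓝 m))
  (hweak : ∀ f : ℝ → ℝ, Continuous f → (∃ C, ∀ x : ℝ, |f x| ≤ C) →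
    Tendsto (fun n : ℕ => ∫ x, f x ∂(scaledMeasure (κ n) (p n) n)) atTop (𝓝 (∫ x, f x ∂μ)))

include hm in
lemma tendsto_pgfMean_div_sqrt :
    Tendsto (fun n : ℕ => pgfMean (p n) / √n) atTop (𝓝 0) :=
  hm.div_atTop (Real.tendsto_sqrt_atTop.comp tendsto_natCast_atTop_atTop)

include h0 h1 h2 hm hweak

lemma measure_Iio_zero_of_scaledMeasure : μ (Set.Iio 0) = 0 :=
  have := fun n => isFiniteMeasure_scaledMeasure (κ := κ n) (n := n) (h0 n) (h1 n) (h2 n)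
  measure_Iio_zero_of_weak (tendsto_pgfMean_div_sqrt hm) (fun _ => ae_scaledMeasure) hweak

include hκ

lemma tendsto_generator {l : ℝ} (hl : 0 ≤ l) {θ : ℕ → ℝ}
    (hθ : ∀ᶠ n : ℕ in atTop, 0 < n ∧ 0 ≤ θ n ∧ Real.exp (-θ n) = 1 - l / √n)
    (ht : Tendsto (fun n : ℕ => √n * θ n) atTop (𝓝 l)) {L : ℝ}
    (hL : Tendsto (fun n : ℕ => κ n * (n * (1 - pgfMean (p n) * l / √n -
      Real.exp (-(pgfMean (p n) * θ n))))) atTop (𝓝 L)) :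
    Tendsto (fun n : ℕ => κ n * (n * (1 - pgfMean (p n) * l / √n - pgf (p n) (1 - l / √n))))
      atTop (𝓝 (L - ((μ {0}).toReal * l ^ 2 / 2 +
        ∫ u in Set.Ioi (0 : ℝ), (Real.exp (-l * u) - 1 + l * u) / u ^ 2 ∂μ))) := by
  have := fun n => isFiniteMeasure_scaledMeasure (κ := κ n) (n := n) (h0 n) (h1 n) (h2 n)
  have hint := tendsto_integral_expRemainder (tendsto_pgfMean_div_sqrt hm)
    (fun _ => ae_scaledMeasure) hweak hl ht
    (hθ.mono fun n hn => mul_nonneg (Real.sqrt_nonneg _) hn.2.1)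
  rw [integral_expRemainder_eq (measure_Iio_zero_of_scaledMeasure h0 h1 h2 hm hweak) hl] at hint
  have hexp : Tendsto (fun n => Real.exp (-(pgfMean (p n) * θ n))) atTop (𝓝 1) := by
    simpa using (hm.mul (tendsto_rate_zero ht)).neg.rexp
  have h := hL.sub (hexp.mul hint)
  rw [one_mul] at h
  refine h.congr' ?_
  filter_upwards [hθ] with n hn
  rw [integral_expRemainder_scaledMeasure (h0 n) (h1 n) (h2 n) (hκ n) hn.1 hn.2.1, hn.2.2]
  have : Real.exp (-(pgfMean (p n) * θ n)) * Real.exp (pgfMean (p n) * θ n) = 1 := by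
    rw [← Real.exp_add, neg_add_cancel, Real.exp_zero]
  linear_combination -(κ n * n * pgf (p n) (1 - l / √n)) * this

omit [IsFiniteMeasure μ] hm in
lemma exists_lipschitz_bound {b : ℝ}
    (hb : Tendsto (fun n => κ n * (pgfMean (p n) ^ 2 - pgfMean (p n))) atTop (𝓝 b))
    {M : ℝ} (hM : 0 ≤ M) :
    ∃ K : ℝ, ∀ (n : ℕ) (l l' : ℝ), l ∈ Set.Icc 0 M → l' ∈ Set.Icc 0 M → l ≤ √n → l' ≤ √n →
      |κ n * (n * (1 - pgfMean (p n) * l / √n - pgf (p n) (1 - l / √n))) -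
        κ n * (n * (1 - pgfMean (p n) * l' / √n - pgf (p n) (1 - l' / √n)))| ≤ K * |l - l'| := by
  obtain ⟨C, hC⟩ := ((tendsto_measureReal_univ_of_weak hweak).add hb).bddAbove_range
  refine ⟨C * M, fun n l l' hl hl' hln hln' => ?_⟩
  refine (abs_generator_sub_le (h0 n) (h1 n) (h2 n) (hκ n) hl hl' hln hln').trans ?_
  have := hC (Set.mem_range_self n)
  gcongr

end Triangular

theorem stmt9
    (p q : ℕ → ℕ → ℝ)
    (hp0 : ∀ n i, 0 ≤ p n i) (hp1 : ∀ n, ∑' i, p n i = 1)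
    (hq0 : ∀ n i, 0 ≤ q n i) (hq1 : ∀ n, ∑' i, q n i = 1)
    -- finite second moments
    (hp2 : ∀ n, Summable fun i : ℕ => (i : ℝ) ^ 2 * p n i)
    (hq2 : ∀ n, Summable fun i : ℕ => (i : ℝ) ^ 2 * q n i)
    (a ω : ℝ) (hω : 0 ≤ ω)
    (hD1 : Tendsto (fun n : ℕ => (n : ℝ) * (pgfMean (p n) - 1)) atTop (𝓝 a))
    (hE1 : Tendsto (fun n : ℕ => pgfMean (q n)) atTop (𝓝 ω))
    (μt νt : Measure ℝ) (hμtfin : IsFiniteMeasure μt) (hνtfin : IsFiniteMeasure νt)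
    -- `μ̃_n → μ̃` weakly
    (hμweak : ∀ f : ℝ → ℝ, Continuous f → (∃ C, ∀ x : ℝ, |f x| ≤ C) →
      Tendsto (fun n : ℕ => ∫ x, f x ∂(tildeMu p n)) atTop (𝓝 (∫ x, f x ∂μt)))
    -- `ν̃_n → ν̃` weakly
    (hνweak : ∀ f : ℝ → ℝ, Continuous f → (∃ C, ∀ x : ℝ, |f x| ≤ C) →
      Tendsto (fun n : ℕ => ∫ x, f x ∂(tildeNu q n)) atTop (𝓝 (∫ x, f x ∂νt))) :
    -- `μ̃` and `ν̃` are supported on `[0, ∞)`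
    μt (Set.Iio 0) = 0 ∧ νt (Set.Iio 0) = 0 ∧
    -- `{G_n}` is uniformly Lipschitz on each bounded interval
    (∀ M > (0 : ℝ), ∃ K : ℝ, ∀ (n : ℕ) (l l' : ℝ),
      l ∈ Set.Icc 0 M → l' ∈ Set.Icc 0 M → l ≤ Real.sqrt n → l' ≤ Real.sqrt n →
      |Gsq p n l - Gsq p n l'| ≤ K * |l - l'|) ∧
    (∀ l : ℝ, 0 ≤ l → Tendsto (fun n => Gsq p n l) atTop
      (𝓝 (-((μt {0}).toReal + a) * l ^ 2 / 2
        - ∫ u in Set.Ioi (0 : ℝ), (Real.exp (-l * u) - 1 + l * u) / u ^ 2 ∂μt))) ∧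
    -- `{H_n}` is uniformly Lipschitz on each bounded interval
    (∀ M > (0 : ℝ), ∃ K : ℝ, ∀ (n : ℕ) (l l' : ℝ),
      l ∈ Set.Icc 0 M → l' ∈ Set.Icc 0 M → l ≤ Real.sqrt n → l' ≤ Real.sqrt n →
      |Hsq q n l - Hsq q n l'| ≤ K * |l - l'|) ∧
    (∀ l : ℝ, 0 ≤ l → Tendsto (fun n => Hsq q n l) atTop
      (𝓝 (-((νt {0}).toReal + ω ^ 2 - ω) * l ^ 2 / 2
        - ∫ u in Set.Ioi (0 : ℝ), (Real.exp (-l * u) - 1 + l * u) / u ^ 2 ∂νt))) := by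
  have hGeq : ∀ n l, Gsq p n l = (n : ℝ) * (n * (1 - pgfMean (p n) * l / √n -
      pgf (p n) (1 - l / √n))) := fun n l => by
    rw [Gsq]
    ring
  have hHeq : ∀ n l, Hsq q n l = (1 : ℝ) * (n * (1 - pgfMean (q n) * l / √n -
      pgf (q n) (1 - l / √n))) := fun n l => (one_mul _).symm
  have hνeq : ∀ n, tildeNu q n = scaledMeasure 1 (q n) n := fun n => by
    simp only [tildeNu, scaledMeasure, one_mul]
  simp only [hνeq] at hνweak
  have hD0 : Tendsto (fun n => pgfMean (p n)) atTop (𝓝 1) := by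
    have h := (hD1.div_atTop tendsto_natCast_atTop_atTop).add_const 1
    rw [zero_add] at h
    refine h.congr' ?_
    filter_upwards [eventually_gt_atTop 0] with n hn
    have : (0 : ℝ) < n := by exact_mod_cast hn
    field_simp
    ring
  have hκp : ∀ n : ℕ, (0 : ℝ) ≤ n := fun n => n.cast_nonneg
  have hκq : ∀ _ : ℕ, (0 : ℝ) ≤ 1 := fun _ => zero_le_one
  refine ⟨measure_Iio_zero_of_scaledMeasure hp0 hp1 hp2 hD0 hμweak,
    measure_Iio_zero_of_scaledMeasure hq0 hq1 hq2 hE1 hνweak, fun M hM => ?_, fun l hl => ?_,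
    fun M hM => ?_, fun l hl => ?_⟩
  · simp only [hGeq]
    refine exists_lipschitz_bound hκp hp0 hp1 hp2 hμweak (b := 1 * a) ?_ hM.le
    exact (hD0.mul hD1).congr fun n => by ring
  · simp only [hGeq]
    obtain ⟨θ, hθ, ht⟩ := exists_exponential_rate hl
    convert! tendsto_generator hκp hp0 hp1 hp2 hD0 hμweak hl hθ ht
      (tendsto_drift_of_tendsto_mul_sub_one hθ ht hD1) using 2
    ring
  · simp only [hHeq]
    exact exists_lipschitz_bound hκq hq0 hq1 hq2 hνweak
      (((hE1.pow 2).sub hE1).const_mul 1) hM.le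
  · simp only [hHeq]
    obtain ⟨θ, hθ, ht⟩ := exists_exponential_rate hl
    convert! tendsto_generator hκq hq0 hq1 hq2 hE1 hνweak hl hθ ht
      ((tendsto_drift_of_tendsto hθ ht hE1).const_mul 1) using 2
    ring
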